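/- Fix α ∈ (0, 1/2). For all real numbers σ, σ′ with 0 < σ ≤ σ′, all μ ≥ 0, and all Ψ ≥ 0, it holds that H(σ, μ, Ψ) ≤ H(σ′, μ, Ψ), where H(σ, μ, Ψ) = Φ((Ψ + μ)/σ + G(μ/σ)) − Φ(Ψ/σ − G(μ/σ)). -/

import Mathlib

open MeasureTheory ProbabilityTheory

/-- The standard normal cumulative distribution function. -/
noncomputable def Phi (x : ℝ) : ℝ := (gaussianReal 0 1 (Set.Iic x)).toReal

/-- `H(σ, μ, Ψ) = Φ((Ψ + μ)/σ + G(μ/σ)) − Φ(Ψ/σ − G(μ/σ))`, for a given `G`. -/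
noncomputable def Hfun (G : ℝ → ℝ) (σ μ Ψ : ℝ) : ℝ :=
  Phi ((Ψ + μ) / σ + G (μ / σ)) - Phi (Ψ / σ - G (μ / σ))

lemma Phi_sub_Phi_eq_integral (a b : ℝ) :
    Phi b - Phi a = ∫ u in a..b, gaussianPDFReal 0 1 u := by
  have hPhi : ∀ x, Phi x = ∫ u in Set.Iic x, gaussianPDFReal 0 1 u := fun x => by
    rw [Phi, gaussianReal_apply_eq_integral _ one_ne_zero,
      ENNReal.toReal_ofReal (integral_nonneg fun u => gaussianPDFReal_nonneg 0 1 u)]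
  rw [hPhi, hPhi]
  exact intervalIntegral.integral_Iic_sub_Iic (integrable_gaussianPDFReal 0 1).integrableOn
    (integrable_gaussianPDFReal 0 1).integrableOn

lemma intervalIntegrable_gaussianPDFReal (a b : ℝ) :
    IntervalIntegrable (gaussianPDFReal 0 1) volume a b :=
  (integrable_gaussianPDFReal 0 1).intervalIntegrable

lemma Phi_strictMono : StrictMono Phi := fun a b hab => by
  rw [← sub_pos, Phi_sub_Phi_eq_integral]
  exact intervalIntegral.intervalIntegral_pos_of_pos (intervalIntegrable_gaussianPDFReal a b)
    (fun u => gaussianPDFReal_pos 0 1 u one_ne_zero) hab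

lemma gaussianPDFReal_add_shift (u x : ℝ) :
    gaussianPDFReal 0 1 (u + x) = Real.exp (-x * u - x ^ 2 / 2) * gaussianPDFReal 0 1 u := by
  simp only [gaussianPDFReal, NNReal.coe_one]
  rw [mul_left_comm, ← Real.exp_add]
  congr 2
  ring

lemma Phi_shift_sub_eq_integral (a b x : ℝ) :
    Phi (b + x) - Phi (a + x) = ∫ u in a..b, gaussianPDFReal 0 1 (u + x) := by
  rw [Phi_sub_Phi_eq_integral, intervalIntegral.integral_comp_add_right]

lemma intervalIntegrable_gaussianPDFReal_shift (a b x : ℝ) :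
    IntervalIntegrable (fun u => gaussianPDFReal 0 1 (u + x)) volume a b :=
  ((integrable_gaussianPDFReal 0 1).comp_add_right x).intervalIntegrable

lemma Phi_shift_sub_le {a b x : ℝ} (hab : a ≤ b) (hx : 0 ≤ x) :
    Phi (b + x) - Phi (a + x) ≤ Real.exp (-x * a - x ^ 2 / 2) * (Phi b - Phi a) := by
  rw [Phi_shift_sub_eq_integral, Phi_sub_Phi_eq_integral, ← intervalIntegral.integral_const_mul]
  refine intervalIntegral.integral_mono_on hab (intervalIntegrable_gaussianPDFReal_shift a b x)
    ((intervalIntegrable_gaussianPDFReal a b).const_mul _) fun u hu => ?_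
  rw [gaussianPDFReal_add_shift]
  refine mul_le_mul_of_nonneg_right (Real.exp_le_exp.2 ?_) (gaussianPDFReal_nonneg 0 1 u)
  nlinarith [hu.1]

lemma le_Phi_shift_sub {a b x : ℝ} (hab : a ≤ b) (hx : 0 ≤ x) :
    Real.exp (-x * b - x ^ 2 / 2) * (Phi b - Phi a) ≤ Phi (b + x) - Phi (a + x) := by
  rw [Phi_shift_sub_eq_integral, Phi_sub_Phi_eq_integral, ← intervalIntegral.integral_const_mul]
  refine intervalIntegral.integral_mono_on hab
    ((intervalIntegrable_gaussianPDFReal a b).const_mul _)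
    (intervalIntegrable_gaussianPDFReal_shift a b x) fun u hu => ?_
  rw [gaussianPDFReal_add_shift]
  refine mul_le_mul_of_nonneg_right (Real.exp_le_exp.2 ?_) (gaussianPDFReal_nonneg 0 1 u)
  nlinarith [hu.2]

/-- Of two intervals with equal Gaussian mass, the right one loses more mass when both are
shifted to the right. -/
lemma Phi_shift_sub_le_of_mass_eq {a b c d x : ℝ} (hab : a ≤ b) (hbc : b ≤ c) (hcd : c ≤ d)
    (hx : 0 ≤ x) (h : Phi d - Phi c = Phi b - Phi a) :
    Phi (d + x) - Phi (c + x) ≤ Phi (b + x) - Phi (a + x) := by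
  refine (Phi_shift_sub_le hcd hx).trans (le_trans ?_ (le_Phi_shift_sub hab hx))
  rw [h]
  refine mul_le_mul_of_nonneg_right (Real.exp_le_exp.2 ?_)
    (sub_nonneg.2 (Phi_strictMono.monotone hab))
  nlinarith

lemma Phi_window_antitone_shift {c y x₁ x₂ : ℝ} (hc : 0 ≤ c) (hy : 0 ≤ y) (hx₁ : 0 ≤ x₁)
    (hx : x₁ ≤ x₂) :
    Phi (x₂ + y + c) - Phi (x₂ - c) ≤ Phi (x₁ + y + c) - Phi (x₁ - c) := by
  have hs : 0 ≤ y + 2 * c := by positivity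
  have h := Phi_shift_sub_le (sub_le_sub_right hx c) hs
  have hexp : Real.exp (-(y + 2 * c) * (x₁ - c) - (y + 2 * c) ^ 2 / 2) ≤ 1 :=
    Real.exp_le_one_iff.2 (by nlinarith [mul_nonneg hs hx₁, mul_nonneg hs hy])
  have hle := mul_le_of_le_one_left
    (sub_nonneg.2 (Phi_strictMono.monotone (sub_le_sub_right hx c))) hexp
  rw [show x₂ - c + (y + 2 * c) = x₂ + y + c by ring,
    show x₁ - c + (y + 2 * c) = x₁ + y + c by ring] at h
  linarith

lemma Phi_window_antitone_width {c₁ c₂ y₁ y₂ x : ℝ} (hc₁ : 0 ≤ c₁) (hc₂ : 0 ≤ c₂) (hy₁ : 0 ≤ y₁)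
    (hy : y₁ ≤ y₂) (hx : 0 ≤ x)
    (h : Phi (c₂ + y₂) - Phi (-c₂) = Phi (c₁ + y₁) - Phi (-c₁)) :
    Phi (x + y₂ + c₂) - Phi (x - c₂) ≤ Phi (x + y₁ + c₁) - Phi (x - c₁) := by
  have hc : c₂ ≤ c₁ := by
    by_contra! hlt
    have h₁ := Phi_strictMono (add_lt_add_of_lt_of_le hlt hy)
    have h₂ := Phi_strictMono (neg_lt_neg hlt)
    linarith
  have hcy : c₁ + y₁ ≤ c₂ + y₂ := by
    by_contra! hlt
    have h₁ := Phi_strictMono hlt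
    have h₂ := Phi_strictMono.monotone (neg_le_neg hc)
    linarith
  have key := Phi_shift_sub_le_of_mass_eq (neg_le_neg hc) (by linarith) hcy hx (by linarith)
  rw [show x + y₂ + c₂ = c₂ + y₂ + x by ring, show x + y₁ + c₁ = c₁ + y₁ + x by ring,
    show x - c₂ = -c₂ + x by ring, show x - c₁ = -c₁ + x by ring]
  linarith

/-- For fixed `α ∈ (0, 1/2)`, with `G` the function assigning to each
`y ≥ 0` the unique `c > 0` with `Φ(c + y) − Φ(−c) = 1 − α`, the function
`H(σ, μ, Ψ) = Φ((Ψ + μ)/σ + G(μ/σ)) − Φ(Ψ/σ − G(μ/σ))` is weakly increasing in `σ`: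
for `0 < σ ≤ σ′`, `μ ≥ 0`, `Ψ ≥ 0`, `H(σ, μ, Ψ) ≤ H(σ′, μ, Ψ)`. -/
theorem H_monotone_in_sigma
    (α : ℝ) (hα : 0 < α) (hα' : α < 1 / 2)
    (G : ℝ → ℝ)
    (hG : ∀ y : ℝ, 0 ≤ y → 0 < G y ∧ Phi (G y + y) - Phi (-(G y)) = 1 - α)
    (σ σ' μ Ψ : ℝ) (hσ : 0 < σ) (hσσ' : σ ≤ σ') (hμ : 0 ≤ μ) (hΨ : 0 ≤ Ψ) :
    Hfun G σ μ Ψ ≤ Hfun G σ' μ Ψ := by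
  have hσ' : 0 < σ' := hσ.trans_le hσσ'
  have hy' : 0 ≤ μ / σ' := div_nonneg hμ hσ'.le
  have hy : μ / σ' ≤ μ / σ := div_le_div_of_nonneg_left hμ hσ hσσ'
  have hx' : 0 ≤ Ψ / σ' := div_nonneg hΨ hσ'.le
  have hx : Ψ / σ' ≤ Ψ / σ := div_le_div_of_nonneg_left hΨ hσ hσσ'
  obtain ⟨hc, hmass⟩ := hG _ (hy'.trans hy)
  obtain ⟨hc', hmass'⟩ := hG _ hy'
  rw [Hfun, Hfun, add_div, add_div]
  exact (Phi_window_antitone_shift hc.le (hy'.trans hy) hx' hx).trans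
    (Phi_window_antitone_width hc'.le hc.le hy' hy hx' (hmass.trans hmass'.symm))
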